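/- There exist η > 0, C > 0 and X₀ > 0 such that the following holds for every integer X ≥ X₀. Let L = ⌊X^{θ+η}⌋, and assume α is a real number for which there exist an integer a and a positive integer q with gcd(a, q) = 1, |α − a/q| < q^{−2} and X^{2θ+10η} ≤ q ≤ X^{1−θ−10η}. Then for all reals M, N, U ≥ 1 with X^{7/22} ≤ M ≤ X^{8/22}, X/(2M) ≤ N ≤ 4X/M and U ≤ L, and all complex coefficients a_m (m ∼ M), b_n (n ∼ N) and c_l (l a nonzero integer with |l| ∼ U) of modulus at most 1, one has |T₁*| ≤ C·X^{1−2η}, where T₁* = Σ_{m ∼ M} Σ_{n ∼ N, mn ∼ X} Σ_{|l| ∼ U} a_m·b_n·c_l·e(α·l·m·n), the sums running over positive integers m, n and nonzero integers l in the indicated ranges. -/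

import Mathlib

open Finset

noncomputable def e (z : ℝ) : ℂ := Complex.exp (2 * Real.pi * Complex.I * z)

noncomputable def nint (x : ℝ) : ℝ := |x - round x|

noncomputable def dyN (Y : ℝ) : Finset ℕ :=
  (Finset.range (⌈Y⌉₊ + 1)).filter fun m => Y/2 ≤ (m:ℝ) ∧ (m:ℝ) < Y

noncomputable def dyZ (Y : ℝ) : Finset ℤ :=
  (Finset.Icc (-(⌈Y⌉₊:ℤ)) (⌈Y⌉₊:ℤ)).filter fun l => l ≠ 0 ∧ Y/2 ≤ |(l:ℝ)| ∧ |(l:ℝ)| < Y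

/-! ### The divisor bound -/

lemma add_one_le_mul_rpow {ε : ℝ} (hε : 0 < ε) {p : ℕ} (hp : 2 ≤ p) (v : ℕ) :
    (v : ℝ) + 1 ≤ (1 + 1 / (ε * Real.log 2)) * ((p : ℝ) ^ v) ^ ε := by
  have hl : 0 < ε * Real.log 2 := mul_pos hε (Real.log_pos one_lt_two)
  have h2 : (2 : ℝ) ≤ p := by exact_mod_cast hp
  have h1 : 1 + v * (ε * Real.log 2) ≤ ((p : ℝ) ^ v) ^ ε := by
    calc 1 + v * (ε * Real.log 2) ≤ Real.exp (v * (ε * Real.log 2)) := by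
          linarith [Real.add_one_le_exp (v * (ε * Real.log 2))]
      _ = ((2 : ℝ) ^ v) ^ ε := by
          rw [Real.rpow_def_of_pos (by positivity), Real.log_pow]; ring_nf
      _ ≤ _ := by gcongr
  calc (v : ℝ) + 1 ≤ (1 + 1 / (ε * Real.log 2)) * (1 + v * (ε * Real.log 2)) := by
        have : (1 + 1 / (ε * Real.log 2)) * (1 + v * (ε * Real.log 2))
            = 1 + v + v * (ε * Real.log 2) + 1 / (ε * Real.log 2) := by field_simp; ring
        rw [this]
        have : 0 ≤ v * (ε * Real.log 2) + 1 / (ε * Real.log 2) := by positivity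
        linarith
    _ ≤ _ := by gcongr

lemma add_one_le_rpow_of_large {ε : ℝ} {p : ℕ} (hp : 2 ≤ (p : ℝ) ^ ε) (v : ℕ) :
    (v : ℝ) + 1 ≤ ((p : ℝ) ^ v) ^ ε := by
  rw [← Real.rpow_natCast, ← Real.rpow_mul (by positivity), mul_comm (v : ℝ),
    Real.rpow_mul (by positivity), Real.rpow_natCast]
  have h : (v : ℝ) + 1 ≤ 2 ^ v := by exact_mod_cast Nat.lt_two_pow_self
  exact h.trans (by gcongr)

/-- The divisor function is bounded by any positive power. -/
theorem exists_card_divisors_le_rpow {ε : ℝ} (hε : 0 < ε) :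
    ∃ C : ℝ, 0 < C ∧ ∀ n : ℕ, n ≠ 0 → (#n.divisors : ℝ) ≤ C * (n : ℝ) ^ ε := by
  set A : ℝ := 1 + 1 / (ε * Real.log 2) with hA
  have hA1 : 1 ≤ A := by
    have : 0 < ε * Real.log 2 := mul_pos hε (Real.log_pos one_lt_two)
    have : 0 < 1 / (ε * Real.log 2) := by positivity
    linarith
  set P : ℕ := ⌈(2 : ℝ) ^ (1 / ε)⌉₊ with hP
  refine ⟨A ^ P, by positivity, fun n hn => ?_⟩
  have hlarge : ∀ p : ℕ, P ≤ p → 2 ≤ (p : ℝ) ^ ε := fun p hp => by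
    calc (2 : ℝ) = ((2 : ℝ) ^ (1 / ε)) ^ ε := by
          rw [← Real.rpow_mul (by norm_num), one_div_mul_cancel hε.ne', Real.rpow_one]
      _ ≤ _ := by gcongr; exact Nat.ceil_le.mp hp
  have hn' : (n : ℝ) ^ ε = ∏ p ∈ n.primeFactors, ((p : ℝ) ^ n.factorization p) ^ ε := by
    rw [Real.finsetProd_rpow _ _ (fun p _ => by positivity)]
    congr 1
    exact_mod_cast (Nat.prod_factorization_pow_eq_self hn).symm
  rw [Nat.card_divisors hn, hn']
  push_cast
  calc ∏ p ∈ n.primeFactors, ((n.factorization p : ℝ) + 1)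
      ≤ ∏ p ∈ n.primeFactors, ((if p < P then A else 1) * ((p : ℝ) ^ n.factorization p) ^ ε) := by
        refine prod_le_prod (fun p _ => by positivity) fun p hp => ?_
        split_ifs with h
        · exact add_one_le_mul_rpow hε (Nat.prime_of_mem_primeFactors hp).two_le _
        · rw [one_mul]; exact add_one_le_rpow_of_large (hlarge p (not_lt.mp h)) _
    _ = (∏ p ∈ n.primeFactors, if p < P then A else 1) *
          ∏ p ∈ n.primeFactors, ((p : ℝ) ^ n.factorization p) ^ ε := prod_mul_distrib
    _ ≤ _ := by
        gcongr
        rw [← prod_filter, prod_const]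
        refine pow_le_pow_right₀ hA1 ?_
        calc _ ≤ #(range P) := card_le_card fun p hp => by simp at hp ⊢; exact hp.2
          _ = P := card_range P

/-! ### Geometric sums of additive characters -/

lemma e_add (x y : ℝ) : e (x + y) = e x * e y := by
  simp only [e, ← Complex.exp_add]; push_cast; ring_nf

lemma e_intCast (k : ℤ) : e k = 1 := by
  rw [e, Complex.exp_eq_one_iff]; exact ⟨k, by push_cast; ring⟩

lemma norm_e (x : ℝ) : ‖e x‖ = 1 := by
  rw [e, show 2 * (Real.pi : ℂ) * Complex.I * x = ((2 * Real.pi * x : ℝ) : ℂ) * Complex.I by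
    push_cast; ring]
  exact Complex.norm_exp_ofReal_mul_I _

lemma conj_e (x : ℝ) : (starRingEnd ℂ) (e x) = e (-x) := by
  simp only [e, ← Complex.exp_conj]
  congr 1
  simp [Complex.conj_ofNat]

lemma e_mul_natCast (x : ℝ) (n : ℕ) : e (x * n) = e x ^ n := by
  simp only [e, ← Complex.exp_nat_mul]; congr 1; push_cast; ring

lemma four_mul_nint_le_norm_e_sub_one (x : ℝ) : 4 * nint x ≤ ‖e x - 1‖ := by
  set δ := x - round x with hδ
  have hx : e x = e δ := by
    rw [show x = δ + (round x : ℤ) by rw [hδ]; ring, e_add, e_intCast, mul_one]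
  have hd : |δ| ≤ 1 / 2 := abs_sub_round x
  have h1 : e δ = Complex.exp (Complex.I * ((2 * Real.pi * δ : ℝ) : ℂ)) := by
    rw [e]; congr 1; push_cast; ring
  rw [hx, h1, Complex.norm_exp_I_mul_ofReal_sub_one, norm_mul, Real.norm_eq_abs, Real.norm_eq_abs,
    show 2 * Real.pi * δ / 2 = Real.pi * δ by ring]
  have h2 : 2 * |δ| ≤ |Real.sin (Real.pi * δ)| := by
    have h3 : 2 / Real.pi * (Real.pi * |δ|) ≤ Real.sin (Real.pi * |δ|) :=
      Real.mul_le_sin (by positivity) (by nlinarith [Real.pi_pos])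
    have h4 : 2 / Real.pi * (Real.pi * |δ|) = 2 * |δ| := by field_simp
    rcases abs_cases δ with h | h <;> rw [h.1] at h3 h4 ⊢
    · rw [h4] at h3; exact h3.trans (le_abs_self _)
    · rw [h4, mul_neg Real.pi, Real.sin_neg] at h3; exact h3.trans (neg_le_abs _)
  have h5 : nint x = |δ| := rfl
  rw [h5, abs_two]; linarith

/-- A sum of additive characters over the integers of a real interval `[lo, hi)`. -/
lemma norm_sum_e_mul_nint_le {S : Finset ℕ} {lo hi : ℝ}
    (hS : ∀ n : ℕ, n ∈ S ↔ lo ≤ n ∧ (n : ℝ) < hi) (x : ℝ) :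
    ‖∑ n ∈ S, e (x * n)‖ * nint x ≤ 1 := by
  have hS' : S = Ico ⌈lo⌉₊ ⌈hi⌉₊ := by
    ext n; rw [hS, mem_Ico, Nat.ceil_le, Nat.lt_ceil]
  rcases le_total ⌈hi⌉₊ ⌈lo⌉₊ with h | h
  · rw [hS', Ico_eq_empty_of_le h]; simp
  have h1 : ‖∑ n ∈ S, e (x * n)‖ * ‖e x - 1‖ ≤ 2 := by
    rw [← norm_mul, hS', sum_congr rfl fun n _ => e_mul_natCast x n, geom_sum_Ico_mul _ h]
    refine (norm_sub_le _ _).trans ?_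
    rw [norm_pow, norm_pow, norm_e]; norm_num
  nlinarith [four_mul_nint_le_norm_e_sub_one x, norm_nonneg (∑ n ∈ S, e (x * n)),
    mul_le_mul_of_nonneg_left (four_mul_nint_le_norm_e_sub_one x)
      (norm_nonneg (∑ n ∈ S, e (x * n)))]

/-! ### Sums over multiples of a real number with a rational approximation -/

lemma one_div_two_mul_le_abs_sub {α : ℝ} {a : ℤ} {q : ℕ} (hq : 0 < q)
    (haq : Int.gcd a (q : ℤ) = 1) (hα : |α - (a : ℝ) / (q : ℝ)| < 1 / (q : ℝ) ^ 2)
    {d : ℤ} (hd : d ≠ 0) (hdq : 2 * |d| ≤ q) (z : ℤ) : 1 / (2 * (q : ℝ)) ≤ |α * d - z| := by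
  have hq' : (0 : ℝ) < q := by exact_mod_cast hq
  have hne : a * d - z * q ≠ 0 := fun h => by
    have h1 : (q : ℤ) ∣ a * d := ⟨z, by linarith⟩
    have h2 : (q : ℤ) ∣ d :=
      IsCoprime.dvd_of_dvd_mul_left (Int.isCoprime_iff_gcd_eq_one.mpr haq).symm h1
    have h3 := Int.le_of_dvd (abs_pos.mpr hd) ((dvd_abs _ _).mpr h2)
    have : 0 < |d| := abs_pos.mpr hd
    omega
  have h1 : (1 : ℝ) ≤ |(a : ℝ) * d - z * q| := by exact_mod_cast Int.one_le_abs hne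
  have hdq' : 2 * |(d : ℝ)| ≤ q := by exact_mod_cast hdq
  have h2 : 1 / (q : ℝ) ≤ |(a : ℝ) / q * d - z| := by
    rw [show (a : ℝ) / q * d - z = (a * d - z * q) / q by field_simp, abs_div, abs_of_pos hq']
    gcongr
  have h3 : |(α - (a : ℝ) / q) * d| ≤ 1 / (2 * q) := by
    rw [abs_mul]
    calc _ ≤ 1 / (q : ℝ) ^ 2 * (q / 2) := by gcongr; linarith
      _ = _ := by field_simp
  have h4 : |(a : ℝ) / q * d - z| ≤ |α * d - z| + |(α - (a : ℝ) / q) * d| := by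
    rw [show (a : ℝ) / q * d - z = (α * d - z) - (α - (a : ℝ) / q) * d by ring]
    exact abs_sub _ _
  have h5 : 1 / (q : ℝ) = 1 / (2 * q) + 1 / (2 * q) := by field_simp; norm_num
  linarith

lemma nint_nonneg (x : ℝ) : 0 ≤ nint x := abs_nonneg _

lemma sum_le_of_injOn_floor {α K : ℝ} {q : ℕ} (hq : 0 < q) {F : ℤ → ℝ}
    (hFK : ∀ h, F h ≤ K) (hF : ∀ h : ℤ, F h * nint (α * h) ≤ 1) (hK : 0 ≤ K) (S : Finset ℤ)
    (hS : Set.InjOn (fun h : ℤ => ⌊2 * (q : ℝ) * nint (α * h)⌋₊) S) :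
    ∑ h ∈ S, F h ≤ K + 2 * q * (1 + Real.log q) := by
  have hq' : (0 : ℝ) < q := by exact_mod_cast hq
  set k : ℤ → ℕ := fun h => ⌊2 * (q : ℝ) * nint (α * h)⌋₊ with hk
  set G : ℕ → ℝ := fun j => if j = 0 then K else 2 * q * (j : ℝ)⁻¹ with hG
  have hG0 : ∀ j, 0 ≤ G j := fun j => by simp only [hG]; split_ifs <;> positivity
  have hFG : ∀ h, F h ≤ G (k h) := fun h => by
    simp only [hG]
    split_ifs with h0
    · exact hFK h
    · have hkpos : (0 : ℝ) < k h := by exact_mod_cast Nat.pos_of_ne_zero h0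
      have h1 : (k h : ℝ) ≤ 2 * q * nint (α * h) :=
        Nat.floor_le (mul_nonneg (by positivity) (nint_nonneg _))
      rw [← div_eq_mul_inv, le_div_iff₀ hkpos]
      rcases le_total (F h) 0 with hneg | hpos
      · nlinarith
      · nlinarith [hF h, mul_le_mul_of_nonneg_left h1 hpos]
  have hmem : ∀ h ∈ S, k h ∈ range (q + 1) := fun h _ => by
    rw [mem_range, Nat.lt_succ_iff]
    refine Nat.floor_le_of_le ?_
    have : nint (α * h) ≤ 1 / 2 := abs_sub_round _
    nlinarith
  calc ∑ h ∈ S, F h ≤ ∑ h ∈ S, G (k h) := sum_le_sum fun h _ => hFG h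
    _ = ∑ j ∈ S.image k, G j := (sum_image hS).symm
    _ ≤ ∑ j ∈ range (q + 1), G j :=
        sum_le_sum_of_subset_of_nonneg (image_subset_iff.mpr hmem) fun j _ _ => hG0 j
    _ = K + 2 * q * (harmonic q : ℝ) := by
        rw [sum_range_succ', harmonic]
        simp [hG, mul_sum, add_comm]
    _ ≤ _ := by gcongr; exact harmonic_le_one_add_log q

lemma sum_le_of_two_mul_abs_sub_le {α K : ℝ} {a : ℤ} {q : ℕ} (hq : 0 < q)
    (haq : Int.gcd a (q : ℤ) = 1) (hα : |α - (a : ℝ) / (q : ℝ)| < 1 / (q : ℝ) ^ 2)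
    {F : ℤ → ℝ} (hFK : ∀ h, F h ≤ K) (hF : ∀ h : ℤ, F h * nint (α * h) ≤ 1) (hK : 0 ≤ K)
    (S : Finset ℤ) (hS : ∀ h ∈ S, ∀ h' ∈ S, 2 * |h - h'| ≤ q) :
    ∑ h ∈ S, F h ≤ 2 * K + 4 * q * (1 + Real.log q) := by
  have hq' : (0 : ℝ) < q := by exact_mod_cast hq
  have key : ∀ T ⊆ S, (∀ h ∈ T, ∀ h' ∈ T, |nint (α * h) - nint (α * h')| =
      |(α * h - round (α * h)) - (α * h' - round (α * h'))|) →
      ∑ h ∈ T, F h ≤ K + 2 * q * (1 + Real.log q) := fun T hT habs => by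
    refine sum_le_of_injOn_floor hq hFK hF hK T fun h hh h' hh' heq => ?_
    by_contra hne
    have h1 := one_div_two_mul_le_abs_sub hq haq hα (sub_ne_zero.mpr hne)
      (hS h (hT hh) h' (hT hh')) (round (α * h) - round (α * h'))
    have h2 := habs h hh h' hh'
    push_cast at h1
    rw [show α * ((h : ℝ) - h') - (round (α * h) - round (α * h')) =
      (α * h - round (α * h)) - (α * h' - round (α * h')) by ring, ← h2] at h1
    have h3 : |2 * (q : ℝ) * nint (α * h) - 2 * (q : ℝ) * nint (α * h')| < 1 := by
      apply Int.abs_sub_lt_one_of_floor_eq_floor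
      rw [← Int.natCast_floor_eq_floor (mul_nonneg (by positivity) (nint_nonneg _)),
        ← Int.natCast_floor_eq_floor (mul_nonneg (by positivity) (nint_nonneg _))]
      exact_mod_cast heq
    rw [← mul_sub, abs_mul, abs_of_pos (by positivity : 0 < 2 * (q : ℝ))] at h3
    rw [div_le_iff₀ (by positivity)] at h1
    linarith
  rw [← sum_filter_add_sum_filter_not S (fun h : ℤ => 0 ≤ α * h - round (α * h))]
  have h1 := key (S.filter fun h : ℤ => 0 ≤ α * h - round (α * h)) (filter_subset _ _) (by
    intro h hh h' hh'
    rw [nint, nint, abs_of_nonneg (mem_filter.mp hh).2, abs_of_nonneg (mem_filter.mp hh').2])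
  have h2 := key (S.filter fun h : ℤ => ¬ 0 ≤ α * h - round (α * h)) (filter_subset _ _) (by
    intro h hh h' hh'
    rw [nint, nint, abs_of_neg (not_le.mp (mem_filter.mp hh).2),
      abs_of_neg (not_le.mp (mem_filter.mp hh').2), ← abs_neg]
    congr 1; ring)
  linarith

/-- The standard bound for `∑ min (K, 1 / ‖α h‖)` over `|h| ≤ H`. -/
lemma sum_Icc_le_of_rational_approx {α K : ℝ} {a : ℤ} {q : ℕ} (hq : 0 < q)
    (haq : Int.gcd a (q : ℤ) = 1) (hα : |α - (a : ℝ) / (q : ℝ)| < 1 / (q : ℝ) ^ 2)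
    {F : ℤ → ℝ} (hFK : ∀ h, F h ≤ K) (hF : ∀ h : ℤ, F h * nint (α * h) ≤ 1) (hK : 0 ≤ K)
    (H : ℕ) :
    ∑ h ∈ Icc (-(H : ℤ)) H, F h ≤
      (4 * (H : ℝ) / q + 2) * (2 * K + 4 * q * (1 + Real.log q)) := by
  have hq' : (0 : ℝ) < q := by exact_mod_cast hq
  set B : ℤ := (q : ℤ) / 2 + 1 with hB
  have hB0 : 0 < B := by omega
  have hB0' : (0 : ℝ) < B := by exact_mod_cast hB0
  have hBq : (q : ℝ) ≤ 2 * B := by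
    have : (q : ℤ) ≤ 2 * B := by omega
    exact_mod_cast this
  have hlog : 0 ≤ Real.log q := Real.log_natCast_nonneg q
  set J : Finset ℤ := Icc (-(H : ℤ) / B) (H / B) with hJ
  have hmap : ∀ h ∈ Icc (-(H : ℤ)) H, h / B ∈ J := fun h hh => by
    rw [mem_Icc] at hh
    exact mem_Icc.mpr ⟨Int.ediv_le_ediv hB0 hh.1, Int.ediv_le_ediv hB0 hh.2⟩
  have hcard : (#J : ℝ) ≤ 4 * H / q + 2 := by
    have h1 : (-(H : ℤ)) / B ≤ H / B := Int.ediv_le_ediv hB0 (by omega)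
    have h2 : (#J : ℤ) = H / B + 1 - (-(H : ℤ)) / B := by
      rw [hJ, Int.card_Icc, Int.toNat_of_nonneg (by omega)]
    have h3 : (#J : ℝ) = ((H / B : ℤ) : ℝ) + 1 - ((-(H : ℤ) / B : ℤ) : ℝ) := by exact_mod_cast h2
    have h4 : ((H / B : ℤ) : ℝ) ≤ H / B := by
      rw [le_div_iff₀ hB0']; exact_mod_cast Int.ediv_mul_le (H : ℤ) hB0.ne'
    have h5 : -((H : ℝ) / B) - 1 ≤ ((-(H : ℤ) / B : ℤ) : ℝ) := by
      have h6 : -(H : ℤ) < (-(H : ℤ) / B + 1) * B := Int.lt_ediv_add_one_mul_self _ hB0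
      have h7 : -(H : ℝ) < (((-(H : ℤ) / B : ℤ) : ℝ) + 1) * B := by exact_mod_cast h6
      have h8 : -(H : ℝ) / B < ((-(H : ℤ) / B : ℤ) : ℝ) + 1 := (div_lt_iff₀ hB0').mpr h7
      rw [neg_div] at h8; linarith
    have h9 : (H : ℝ) / B ≤ 2 * H / q := by
      rw [div_le_div_iff₀ hB0' hq']; nlinarith [Nat.cast_nonneg (α := ℝ) H]
    have h10 : 4 * (H : ℝ) / q = 2 * (2 * H / q) := by ring
    linarith
  rw [← sum_fiberwise_of_maps_to hmap]
  calc _ ≤ ∑ _j ∈ J, (2 * K + 4 * q * (1 + Real.log q)) := by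
        refine sum_le_sum fun j _ => sum_le_of_two_mul_abs_sub_le hq haq hα hFK hF hK _ ?_
        intro h hh h' hh'
        have e1 := (mem_filter.mp hh).2
        have e2 := (mem_filter.mp hh').2
        have r1 := Int.mul_ediv_add_emod h B
        have r2 := Int.mul_ediv_add_emod h' B
        rw [e1] at r1
        rw [e2] at r2
        have := Int.emod_nonneg h hB0.ne'
        have := Int.emod_nonneg h' hB0.ne'
        have := Int.emod_lt_of_pos h hB0
        have := Int.emod_lt_of_pos h' hB0
        have : |h - h'| ≤ B - 1 := by rw [abs_le]; constructor <;> linarith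
        omega
    _ = #J * (2 * K + 4 * q * (1 + Real.log q)) := by rw [sum_const, nsmul_eq_mul]
    _ ≤ _ := by gcongr

/-! ### Bilinear sums -/

/-- Cauchy–Schwarz for a bilinear sum, removing the coefficients `b` and `w`. -/
lemma norm_sq_bilinear_le {ι : Type*} (S : Finset ℕ) (P : Finset ι) (b : ℕ → ℂ) (w : ι → ℂ)
    (g : ι → ℕ → ℂ) (hb : ∀ n ∈ S, ‖b n‖ ≤ 1) (hw : ∀ p ∈ P, ‖w p‖ ≤ 1) :
    ‖∑ n ∈ S, b n * ∑ p ∈ P, w p * g p n‖ ^ 2 ≤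
      #S * ∑ p ∈ P, ∑ p' ∈ P, ‖∑ n ∈ S, g p n * (starRingEnd ℂ) (g p' n)‖ := by
  set z : ℕ → ℂ := fun n => ∑ p ∈ P, w p * g p n with hz
  have h1 : ‖∑ n ∈ S, b n * z n‖ ≤ ∑ n ∈ S, ‖z n‖ :=
    (norm_sum_le _ _).trans <| sum_le_sum fun n hn => by
      rw [norm_mul]; exact mul_le_of_le_one_left (norm_nonneg _) (hb n hn)
  have h2 : ((∑ n ∈ S, ‖z n‖ ^ 2 : ℝ) : ℂ) = ∑ p ∈ P, ∑ p' ∈ P,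
      w p * (starRingEnd ℂ) (w p') * ∑ n ∈ S, g p n * (starRingEnd ℂ) (g p' n) := by
    push_cast
    simp_rw [← Complex.mul_conj', hz, map_sum, sum_mul_sum, map_mul, mul_sum]
    rw [sum_comm]
    refine sum_congr rfl fun p _ => ?_
    rw [sum_comm]
    refine sum_congr rfl fun p' _ => sum_congr rfl fun n _ => by ring
  have h3 : ∑ n ∈ S, ‖z n‖ ^ 2 ≤
      ∑ p ∈ P, ∑ p' ∈ P, ‖∑ n ∈ S, g p n * (starRingEnd ℂ) (g p' n)‖ := by
    calc ∑ n ∈ S, ‖z n‖ ^ 2 = ‖((∑ n ∈ S, ‖z n‖ ^ 2 : ℝ) : ℂ)‖ := by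
          rw [Complex.norm_real, Real.norm_of_nonneg (sum_nonneg fun n _ => by positivity)]
      _ ≤ _ := by
          rw [h2]
          refine (norm_sum_le _ _).trans <| sum_le_sum fun p hp =>
            (norm_sum_le _ _).trans <| sum_le_sum fun p' hp' => ?_
          rw [norm_mul, norm_mul, RCLike.norm_conj]
          exact mul_le_of_le_one_left (norm_nonneg _)
            (mul_le_one₀ (hw p hp) (norm_nonneg _) (hw p' hp'))
  calc _ ≤ (∑ n ∈ S, ‖z n‖) ^ 2 := by gcongr
    _ ≤ #S * ∑ n ∈ S, ‖z n‖ ^ 2 := sq_sum_le_card_mul_sum_sq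
    _ ≤ _ := by gcongr

lemma sum_sum_sub_le {ι : Type*} (P : Finset ι) (t : ι → ℤ) (F : ℤ → ℝ) (hF : ∀ h, 0 ≤ F h)
    {D : ℝ} (hD : ∀ k, (#{p ∈ P | t p = k} : ℝ) ≤ D) (J : Finset ℤ)
    (hJ : ∀ p ∈ P, ∀ p' ∈ P, t p - t p' ∈ J) :
    ∑ p ∈ P, ∑ p' ∈ P, F (t p - t p') ≤ #P * (D * ∑ h ∈ J, F h) := by
  rw [sum_comm, ← nsmul_eq_mul, ← sum_const]
  refine sum_le_sum fun p' hp' => ?_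
  rw [← sum_fiberwise_of_maps_to (fun p hp => hJ p hp p' hp'), mul_sum]
  refine sum_le_sum fun h _ => ?_
  rw [sum_congr rfl fun p hp => by rw [(mem_filter.mp hp).2], sum_const, nsmul_eq_mul]
  refine mul_le_mul_of_nonneg_right ?_ (hF h)
  simpa only [sub_eq_iff_eq_add] using hD (h + t p')

/-! ### Dyadic ranges -/

lemma mem_dyN {Y : ℝ} {m : ℕ} : m ∈ dyN Y ↔ Y / 2 ≤ m ∧ (m : ℝ) < Y := by
  rw [dyN, mem_filter, mem_range, and_iff_right_iff_imp]
  intro h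
  have : (m : ℝ) < ⌈Y⌉₊ := h.2.trans_le (Nat.le_ceil Y)
  have : m < ⌈Y⌉₊ := by exact_mod_cast this
  omega

lemma card_dyN_le {Y : ℝ} (hY : 1 ≤ Y) : (#(dyN Y) : ℝ) ≤ 3 * Y := by
  have h1 : #(dyN Y) ≤ ⌈Y⌉₊ + 1 := (card_filter_le _ _).trans (card_range _).le
  have h2 : (#(dyN Y) : ℝ) ≤ ⌈Y⌉₊ + 1 := by exact_mod_cast h1
  linarith [Nat.ceil_lt_add_one (zero_le_one.trans hY)]

lemma card_dyZ_le {Y : ℝ} (hY : 1 ≤ Y) : (#(dyZ Y) : ℝ) ≤ 5 * Y := by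
  have h1 : #(dyZ Y) ≤ 2 * ⌈Y⌉₊ + 1 := by
    refine (card_filter_le _ _).trans ?_
    rw [Int.card_Icc]; omega
  have h2 : (#(dyZ Y) : ℝ) ≤ 2 * ⌈Y⌉₊ + 1 := by exact_mod_cast h1
  linarith [Nat.ceil_lt_add_one (zero_le_one.trans hY)]

lemma abs_mul_lt_of_mem_dyN_of_mem_dyZ {M U : ℝ} {m : ℕ} {l : ℤ} (hm : m ∈ dyN M)
    (hl : l ∈ dyZ U) : |((l * m : ℤ) : ℝ)| < U * M := by
  have hl' := (mem_filter.mp hl).2.2.2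
  push_cast
  rw [abs_mul, Nat.abs_cast]
  exact mul_lt_mul'' hl' (mem_dyN.mp hm).2 (abs_nonneg _) (by positivity)

/-- The number of factorisations `k = l * m` is controlled by the divisor bound. -/
lemma card_filter_mul_eq_le {M U C ε : ℝ} (hM : 0 < M) (hU : 0 < U) (hC : 0 < C) (hε : 0 < ε)
    (hdiv : ∀ n : ℕ, n ≠ 0 → (#n.divisors : ℝ) ≤ C * (n : ℝ) ^ ε) (k : ℤ) :
    (#{p ∈ dyN M ×ˢ dyZ U | p.2 * (p.1 : ℤ) = k} : ℝ) ≤ C * (U * M) ^ ε := by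
  rcases ({p ∈ dyN M ×ˢ dyZ U | p.2 * (p.1 : ℤ) = k}).eq_empty_or_nonempty with h0 | ⟨p₀, hp₀⟩
  · rw [h0, card_empty, Nat.cast_zero]
    positivity
  have hpos : ∀ p ∈ {p ∈ dyN M ×ˢ dyZ U | p.2 * (p.1 : ℤ) = k}, (p.1 : ℤ) ≠ 0 ∧ p.2 ≠ 0 :=
    fun p hp => by
      have hp' := mem_product.mp (mem_filter.mp hp).1
      refine ⟨fun h => ?_, (mem_filter.mp hp'.2).2.1⟩
      have h1 := (mem_dyN.mp hp'.1).1
      rw [show p.1 = 0 by exact_mod_cast h] at h1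
      push_cast at h1; linarith
  have hk : k ≠ 0 := by
    rw [← (mem_filter.mp hp₀).2]
    exact mul_ne_zero (hpos p₀ hp₀).2 (hpos p₀ hp₀).1
  have hkU : ((k.natAbs : ℕ) : ℝ) ≤ U * M := by
    have hp' := mem_product.mp (mem_filter.mp hp₀).1
    have := abs_mul_lt_of_mem_dyN_of_mem_dyZ hp'.1 hp'.2
    rw [(mem_filter.mp hp₀).2] at this
    rw [Nat.cast_natAbs, Int.cast_abs]; exact this.le
  have hcard : #{p ∈ dyN M ×ˢ dyZ U | p.2 * (p.1 : ℤ) = k} ≤ #k.natAbs.divisors := by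
    refine card_le_card_of_injOn Prod.fst (fun p hp => ?_) fun p hp p' hp' h => ?_
    · have h1 := (mem_filter.mp hp).2
      rw [mem_coe, Nat.mem_divisors]
      exact ⟨Int.natCast_dvd.mp ⟨p.2, by rw [← h1, mul_comm]⟩, Int.natAbs_ne_zero.mpr hk⟩
    · have h1 := (mem_filter.mp hp).2
      have h2 := (mem_filter.mp hp').2
      rw [← h2, ← h] at h1
      exact Prod.ext h (mul_right_cancel₀ (hpos p hp).1 h1)
  calc _ ≤ (#k.natAbs.divisors : ℝ) := by exact_mod_cast hcard
    _ ≤ C * (k.natAbs : ℝ) ^ ε := hdiv _ (Int.natAbs_ne_zero.mpr hk)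
    _ ≤ _ := by gcongr

set_option maxHeartbeats 800000 in
/-- The trilinear sum is controlled by the divisor bound and the rational approximation. -/
theorem norm_sq_trilinear_le {α : ℝ} {a : ℤ} {q : ℕ} (hq : 0 < q)
    (haq : Int.gcd a (q : ℤ) = 1) (hα : |α - (a : ℝ) / (q : ℝ)| < 1 / (q : ℝ) ^ 2)
    {C ε : ℝ} (hC : 0 < C) (hε : 0 < ε)
    (hdiv : ∀ n : ℕ, n ≠ 0 → (#n.divisors : ℝ) ≤ C * (n : ℝ) ^ ε)
    {M N U : ℝ} (hM : 1 ≤ M) (hN : 1 ≤ N) (hU : 1 ≤ U) (X : ℝ)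
    (am bn : ℕ → ℂ) (cl : ℤ → ℂ) (ha : ∀ m ∈ dyN M, ‖am m‖ ≤ 1)
    (hb : ∀ n ∈ dyN N, ‖bn n‖ ≤ 1) (hc : ∀ l ∈ dyZ U, ‖cl l‖ ≤ 1) :
    ‖∑ m ∈ dyN M, ∑ n ∈ (dyN N).filter (fun n => X / 2 ≤ ((m * n : ℕ) : ℝ) ∧
        ((m * n : ℕ) : ℝ) < X), ∑ l ∈ dyZ U,
        am m * bn n * cl l * e (α * (l : ℝ) * (m : ℝ) * (n : ℝ))‖ ^ 2 ≤
      3 * N * (15 * (M * U) * (C * (U * M) ^ ε *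
        ((8 * (U * M) / q + 2) * (6 * N + 4 * q * (1 + Real.log q))))) := by
  set P := dyN M ×ˢ dyZ U with hP
  set t : ℕ × ℤ → ℤ := fun p => p.2 * (p.1 : ℤ) with ht
  set g : ℕ × ℤ → ℕ → ℂ := fun p n =>
    if X / 2 ≤ ((p.1 * n : ℕ) : ℝ) ∧ ((p.1 * n : ℕ) : ℝ) < X then e (α * t p * n) else 0 with hg
  set F : ℤ → ℝ := fun h =>
    if nint (α * h) = 0 then 3 * N else min (3 * N) (1 / nint (α * h)) with hF
  have hlog : 0 ≤ Real.log q := Real.log_natCast_nonneg q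
  have hn0 : ∀ h : ℤ, 0 ≤ nint (α * h) := fun h => nint_nonneg _
  have hF0 : ∀ h, 0 ≤ F h := fun h => by
    simp only [hF]; split_ifs
    · positivity
    · exact le_min (by positivity) (one_div_nonneg.mpr (hn0 h))
  have hFK : ∀ h, F h ≤ 3 * N := fun h => by
    simp only [hF]; split_ifs
    · exact le_rfl
    · exact min_le_left _ _
  have hFn : ∀ h : ℤ, F h * nint (α * h) ≤ 1 := fun h => by
    simp only [hF]; split_ifs with h0
    · rw [h0, mul_zero]; exact zero_le_one
    · calc _ ≤ 1 / nint (α * h) * nint (α * h) :=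
            mul_le_mul_of_nonneg_right (min_le_right _ _) (hn0 h)
        _ = 1 := one_div_mul_cancel h0
  have hFle : ∀ (x : ℝ) (h : ℤ), x ≤ 3 * N → x * nint (α * h) ≤ 1 → x ≤ F h :=
    fun x h h1 h2 => by
      simp only [hF]; split_ifs with h0
      · exact h1
      · exact le_min h1 ((le_div_iff₀ ((hn0 h).lt_of_ne' h0)).mpr h2)
  have hswap : ∑ m ∈ dyN M, ∑ n ∈ (dyN N).filter (fun n => X / 2 ≤ ((m * n : ℕ) : ℝ) ∧
        ((m * n : ℕ) : ℝ) < X), ∑ l ∈ dyZ U,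
        am m * bn n * cl l * e (α * (l : ℝ) * (m : ℝ) * (n : ℝ)) =
      ∑ n ∈ dyN N, bn n * ∑ p ∈ P, am p.1 * cl p.2 * g p n := by
    simp_rw [sum_filter]
    rw [sum_comm]
    refine sum_congr rfl fun n _ => ?_
    rw [hP, sum_product, mul_sum]
    refine sum_congr rfl fun m _ => ?_
    simp only [hg, ht]
    split_ifs
    · rw [mul_sum]
      refine sum_congr rfl fun l _ => ?_
      push_cast
      ring_nf
    · simp
  have hcorr : ∀ p ∈ P, ∀ p' ∈ P,
      ‖∑ n ∈ dyN N, g p n * (starRingEnd ℂ) (g p' n)‖ ≤ F (t p - t p') := fun p hp p' hp' => by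
    have hpos : ∀ p ∈ P, (0 : ℝ) < p.1 := fun p hp => by
      linarith [(mem_dyN.mp (mem_product.mp hp).1).1]
    set S := (dyN N).filter fun n => (X / 2 ≤ ((p.1 * n : ℕ) : ℝ) ∧ ((p.1 * n : ℕ) : ℝ) < X) ∧
      (X / 2 ≤ ((p'.1 * n : ℕ) : ℝ) ∧ ((p'.1 * n : ℕ) : ℝ) < X) with hS
    have hsum : ∑ n ∈ dyN N, g p n * (starRingEnd ℂ) (g p' n) =
        ∑ n ∈ S, e (α * ((t p - t p' : ℤ) : ℝ) * n) := by
      rw [hS, sum_filter]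
      refine sum_congr rfl fun n _ => ?_
      simp only [hg]
      split_ifs <;> first | tauto | skip
      · rw [conj_e, ← e_add]; push_cast; ring_nf
      all_goals simp
    rw [hsum]
    apply hFle
    · refine (norm_sum_le _ _).trans ?_
      simp only [norm_e, sum_const, nsmul_eq_mul, mul_one]
      exact (Nat.cast_le.mpr (card_filter_le _ _)).trans (card_dyN_le hN)
    · refine norm_sum_e_mul_nint_le
        (lo := max (N / 2) (max (X / 2 / p.1) (X / 2 / p'.1)))
        (hi := min N (min (X / p.1) (X / p'.1))) (fun n => ?_) _
      rw [hS, mem_filter, mem_dyN, max_le_iff, max_le_iff, lt_min_iff, lt_min_iff,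
        div_le_iff₀' (hpos p hp), div_le_iff₀' (hpos p' hp'), lt_div_iff₀' (hpos p hp),
        lt_div_iff₀' (hpos p' hp')]
      push_cast
      tauto
  have hcardP : (#P : ℝ) ≤ 15 * (M * U) := by
    rw [hP, card_product]; push_cast
    calc (#(dyN M) : ℝ) * #(dyZ U) ≤ (3 * M) * (5 * U) := by
          gcongr
          exacts [card_dyN_le hM, card_dyZ_le hU]
      _ = _ := by ring
  set H : ℕ := ⌊2 * (U * M)⌋₊ with hH
  have hH' : (H : ℝ) ≤ 2 * (U * M) := Nat.floor_le (by positivity)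
  have hJ : ∀ p ∈ P, ∀ p' ∈ P, t p - t p' ∈ Icc (-(H : ℤ)) H := fun p hp p' hp' => by
    have h1 := abs_mul_lt_of_mem_dyN_of_mem_dyZ (mem_product.mp hp).1 (mem_product.mp hp).2
    have h2 := abs_mul_lt_of_mem_dyN_of_mem_dyZ (mem_product.mp hp').1 (mem_product.mp hp').2
    rw [mem_Icc, ← abs_le, Int.abs_eq_natAbs]
    refine Int.ofNat_le.mpr (Nat.le_floor ?_)
    rw [Nat.cast_natAbs, Int.cast_abs, Int.cast_sub]
    exact (abs_sub _ _).trans (by linarith)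
  have hV := sum_Icc_le_of_rational_approx hq haq hα hFK hFn (by positivity) H
  have hsq := norm_sq_bilinear_le (dyN N) P bn (fun p => am p.1 * cl p.2) g hb fun p hp => by
    rw [norm_mul]
    exact mul_le_one₀ (ha _ (mem_product.mp hp).1) (norm_nonneg _) (hc _ (mem_product.mp hp).2)
  rw [hswap]
  refine hsq.trans ?_
  calc _ ≤ #(dyN N) * ∑ p ∈ P, ∑ p' ∈ P, F (t p - t p') := by
        gcongr with p hp p' hp'
        exact hcorr p hp p' hp'
    _ ≤ #(dyN N) * (#P * (C * (U * M) ^ ε * ∑ h ∈ Icc (-(H : ℤ)) H, F h)) := by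
        gcongr
        exact sum_sum_sub_le P t F hF0 (card_filter_mul_eq_le (by positivity) (by positivity) hC hε hdiv) _ hJ
    _ ≤ 3 * N * (15 * (M * U) * (C * (U * M) ^ ε *
          ((4 * (H : ℝ) / q + 2) * (2 * (3 * N) + 4 * q * (1 + Real.log q))))) := by
        have h0 : 0 ≤ ∑ h ∈ Icc (-(H : ℤ)) H, F h := sum_nonneg fun h _ => hF0 h
        gcongr
        exact card_dyN_le hN
    _ ≤ 3 * N * (15 * (M * U) * (C * (U * M) ^ ε *
          ((4 * (2 * (U * M)) / q + 2) * (2 * (3 * N) + 4 * q * (1 + Real.log q))))) := by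
        gcongr
    _ = _ := by ring

lemma one_add_log_natCast_le {q : ℕ} {x ε : ℝ} (hε : 0 < ε) (hx : 1 ≤ x) (hqx : (q : ℝ) ≤ x) :
    1 + Real.log q ≤ (1 + 1 / ε) * x ^ ε := by
  have h1 : Real.log q ≤ x ^ ε / ε :=
    (Real.log_natCast_le_rpow_div q hε).trans (by gcongr)
  have h2 : (1 : ℝ) ≤ x ^ ε := Real.one_le_rpow hx hε.le
  calc 1 + Real.log q ≤ x ^ ε + x ^ ε / ε := add_le_add h2 h1
    _ = _ := by ring

/-- The four terms of the bilinear estimate in the range of parameters under consideration. -/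
lemma trilinear_main_terms_le {x θ M N U q : ℝ} (hx : 1 ≤ x) (hθ : θ < 1 / 10) (hM : 0 < M)
    (hN : 0 < N) (hU : 0 < U) (hq : 0 < q)
    (hq1 : x ^ (2 * θ + 10 * (1 / 100)) ≤ q) (hq2 : q ≤ x ^ (1 - θ - 10 * (1 / 100)))
    (hM1 : x ^ ((7 : ℝ) / 22) ≤ M) (hM2 : M ≤ x ^ ((8 : ℝ) / 22)) (hNM : N ≤ 4 * x / M)
    (hUx : U ≤ x ^ (θ + 1 / 100)) :
    N * M * U * ((U * M / q + 1) * (N + q)) ≤ 40 * (x * x ^ ((92 : ℝ) / 100)) := by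
  have hx0 : 0 < x := by linarith
  have hNM' : N * M ≤ 4 * x := (le_div_iff₀ hM).mp hNM
  have hU2 : U ^ 2 ≤ x ^ (2 * θ + 2 / 100) := by
    calc U ^ 2 ≤ (x ^ (θ + 1 / 100)) ^ 2 := by gcongr
      _ = _ := by rw [← Real.rpow_natCast, ← Real.rpow_mul hx0.le]; congr 1; push_cast; ring
  have h1 : U ^ 2 * x / q ≤ x ^ ((92 : ℝ) / 100) := by
    rw [div_le_iff₀ hq]
    calc U ^ 2 * x ≤ x ^ (2 * θ + 2 / 100) * x ^ (1 : ℝ) := by rw [Real.rpow_one]; gcongr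
      _ = x ^ ((92 : ℝ) / 100) * x ^ (2 * θ + 10 * (1 / 100)) := by
          rw [← Real.rpow_add hx0, ← Real.rpow_add hx0]; congr 1; ring
      _ ≤ _ := by gcongr
  have h2 : U ^ 2 * M ≤ x ^ ((92 : ℝ) / 100) := by
    calc U ^ 2 * M ≤ x ^ (2 * θ + 2 / 100) * x ^ ((8 : ℝ) / 22) := by gcongr
      _ = x ^ (2 * θ + 2 / 100 + 8 / 22) := (Real.rpow_add hx0 _ _).symm
      _ ≤ _ := Real.rpow_le_rpow_of_exponent_le hx (by linarith)
  have h3 : U * N ≤ 4 * x ^ ((92 : ℝ) / 100) := by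
    calc U * N ≤ x ^ (θ + 1 / 100) * (4 * x ^ (1 : ℝ) / x ^ ((7 : ℝ) / 22)) := by
          rw [Real.rpow_one]
          gcongr
          exact hNM.trans (by gcongr)
      _ = 4 * x ^ (θ + 1 / 100 + (1 - 7 / 22)) := by
          rw [mul_div_assoc, ← Real.rpow_sub hx0, mul_left_comm, ← Real.rpow_add hx0]
      _ ≤ _ := by
          gcongr
          linarith
  have h4 : U * q ≤ x ^ ((92 : ℝ) / 100) := by
    calc U * q ≤ x ^ (θ + 1 / 100) * x ^ (1 - θ - 10 * (1 / 100)) := by gcongr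
      _ = x ^ (θ + 1 / 100 + (1 - θ - 10 * (1 / 100))) := (Real.rpow_add hx0 _ _).symm
      _ ≤ _ := Real.rpow_le_rpow_of_exponent_le hx (by linarith)
  have h5 : U ^ 2 * (N * M) / q ≤ 4 * x ^ ((92 : ℝ) / 100) := by
    calc U ^ 2 * (N * M) / q ≤ U ^ 2 * (4 * x) / q := by gcongr
      _ = 4 * (U ^ 2 * x / q) := by ring
      _ ≤ _ := by gcongr
  calc N * M * U * ((U * M / q + 1) * (N + q))
      = (N * M) * (U ^ 2 * (N * M) / q + U ^ 2 * M + U * N + U * q) := by field_simp; ring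
    _ ≤ (4 * x) * (4 * x ^ ((92 : ℝ) / 100) + x ^ ((92 : ℝ) / 100) +
          4 * x ^ ((92 : ℝ) / 100) + x ^ ((92 : ℝ) / 100)) := by gcongr
    _ = _ := by ring

theorem T1_bound (c γ θ : ℝ) (hc1 : 1 < c) (hc2 : c < 9/8) (hγ : γ = 1/c)
    (hθ1 : 0 < θ) (hθ2 : θ < (9*γ - 8)/10) :
    ∃ η > (0:ℝ), ∃ C > (0:ℝ), ∃ X₀ > (0:ℝ), ∀ X : ℕ, X₀ ≤ (X:ℝ) →
    ∀ α : ℝ, (∃ a : ℤ, ∃ q : ℕ, 0 < q ∧ Int.gcd a (q:ℤ) = 1 ∧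
        |α - (a:ℝ)/(q:ℝ)| < 1/(q:ℝ)^2 ∧
        (X:ℝ)^(2*θ+10*η) ≤ (q:ℝ) ∧ (q:ℝ) ≤ (X:ℝ)^(1-θ-10*η)) →
    ∀ M N U : ℝ, 1 ≤ M → 1 ≤ N → 1 ≤ U →
    (X:ℝ)^((7:ℝ)/22) ≤ M → M ≤ (X:ℝ)^((8:ℝ)/22) →
    (X:ℝ)/(2*M) ≤ N → N ≤ 4*(X:ℝ)/M → U ≤ (⌊(X:ℝ)^(θ+η)⌋₊ : ℝ) →
    ∀ am bn : ℕ → ℂ, ∀ cl : ℤ → ℂ,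
    (∀ m ∈ dyN M, ‖am m‖ ≤ 1) → (∀ n ∈ dyN N, ‖bn n‖ ≤ 1) → (∀ l ∈ dyZ U, ‖cl l‖ ≤ 1) →
    ‖∑ m ∈ dyN M, ∑ n ∈ (dyN N).filter (fun n => (X:ℝ)/2 ≤ ((m*n:ℕ):ℝ) ∧ ((m*n:ℕ):ℝ) < (X:ℝ)),
        ∑ l ∈ dyZ U, am m * bn n * cl l * e (α * (l:ℝ) * (m:ℝ) * (n:ℝ))‖ ≤ C * (X:ℝ)^(1-2*η) := by
  have hθ : θ < 1 / 10 := by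
    have : γ < 1 := by rw [hγ]; exact (div_lt_one (by linarith)).mpr hc1
    linarith
  obtain ⟨C, hC, hdiv⟩ := exists_card_divisors_le_rpow (ε := 1 / 100) (by norm_num)
  set K : ℝ := 45 * C * 8 * 404 * 40 with hK
  refine ⟨1 / 100, by norm_num, √K, by positivity, 1, one_pos, ?_⟩
  rintro X hX α ⟨a, q, hq, haq, hα, hq1, hq2⟩ M N U hM hN hU hM1 hM2 - hNM hUL am bn cl ha hb hc
  set x : ℝ := (X : ℝ) with hx
  have hx0 : 0 < x := by linarith
  have hq' : (0 : ℝ) < q := by exact_mod_cast hq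
  have hUx : U ≤ x ^ (θ + 1 / 100) := hUL.trans (Nat.floor_le (by positivity))
  have hUM : U * M ≤ x := by
    calc U * M ≤ x ^ (θ + 1 / 100) * x ^ ((8 : ℝ) / 22) := by gcongr
      _ = x ^ (θ + 1 / 100 + 8 / 22) := (Real.rpow_add hx0 _ _).symm
      _ ≤ x ^ (1 : ℝ) := Real.rpow_le_rpow_of_exponent_le hX (by linarith)
      _ = x := Real.rpow_one x
  have hqx : (q : ℝ) ≤ x := by
    calc (q : ℝ) ≤ x ^ (1 : ℝ) :=
          hq2.trans (Real.rpow_le_rpow_of_exponent_le hX (by linarith))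
      _ = x := Real.rpow_one x
  have hlog := one_add_log_natCast_le (ε := 1 / 100) (by norm_num) hX hqx
  have hy : 1 ≤ x ^ ((1 : ℝ) / 100) := Real.one_le_rpow hX (by norm_num)
  have hmain := trilinear_main_terms_le hX hθ (by linarith) (by linarith) (by linarith) hq' hq1 hq2
    hM1 hM2 hNM hUx
  have hT := norm_sq_trilinear_le hq haq hα hC (by norm_num) hdiv hM hN hU x am bn cl ha hb hc
  set y : ℝ := x ^ ((1 : ℝ) / 100) with hydef
  refine le_of_sq_le_sq (hT.trans ?_) (by positivity)
  have hA : 6 * N + 4 * q * (1 + Real.log q) ≤ 404 * (y * (N + q)) := by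
    have e1 : 4 * q * (1 + Real.log q) ≤ 4 * q * ((1 + 1 / (1 / 100)) * y) := by gcongr
    have e2 : N ≤ y * N := le_mul_of_one_le_left (by linarith) hy
    linarith [e1, e2]
  have hB : 8 * (U * M) / q + 2 ≤ 8 * (U * M / q + 1) := by
    have : 8 * (U * M) / q = 8 * (U * M / q) := by ring
    linarith
  have hlog0 : 0 ≤ Real.log q := Real.log_natCast_nonneg q
  calc 3 * N * (15 * (M * U) * (C * (U * M) ^ ((1 : ℝ) / 100) *
        ((8 * (U * M) / q + 2) * (6 * N + 4 * q * (1 + Real.log q)))))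
      ≤ 3 * N * (15 * (M * U) * (C * y *
        ((8 * (U * M / q + 1)) * (404 * (y * (N + q)))))) := by
        gcongr
        exact Real.rpow_le_rpow (by positivity) hUM (by norm_num)
    _ = 45 * C * 8 * 404 * y ^ 2 * (N * M * U * ((U * M / q + 1) * (N + q))) := by ring
    _ ≤ 45 * C * 8 * 404 * y ^ 2 * (40 * (x * x ^ ((92 : ℝ) / 100))) := by gcongr
    _ = K * (y ^ 2 * (x * x ^ ((92 : ℝ) / 100))) := by rw [hK]; ring
    _ = K * x ^ ((194 : ℝ) / 100) := by
        rw [hydef, ← Real.rpow_natCast, ← Real.rpow_mul hx0.le, ← Real.rpow_one_add' hx0.le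
          (by norm_num), ← Real.rpow_add hx0]
        norm_num
    _ ≤ K * x ^ ((196 : ℝ) / 100) := by
        gcongr
        norm_num
    _ = (√K * x ^ (1 - 2 * (1 / 100) : ℝ)) ^ 2 := by
        rw [mul_pow, Real.sq_sqrt (by positivity), ← Real.rpow_natCast (x ^ _),
          ← Real.rpow_mul hx0.le]
        norm_num
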